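/- Every ternary cubic form f over ℝ with Δ(f) ≠ 0 is SL₃(ℝ)-equivalent to a form in Weierstrass form, i.e., there exist γ ∈ SL₃(ℝ) and A, B ∈ ℝ with γ·f = x³ + A·x·z² + B·z³ − y²·z. -/

import Mathlib

open MvPolynomial

/-- The action of a 3×3 matrix on ternary forms: `(γ·f)(x,y,z) = f((x,y,z)·γ)`. -/
noncomputable def actGL {R : Type*} [CommRing R] (γ : Matrix (Fin 3) (Fin 3) R)
    (f : MvPolynomial (Fin 3) R) : MvPolynomial (Fin 3) R :=
  bind₁ (fun j => ∑ i : Fin 3, C (γ i j) * X i) f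

/-- The Hessian of a ternary form: the determinant of the matrix of second partials. -/
noncomputable def hess {R : Type*} [CommRing R] (f : MvPolynomial (Fin 3) R) :
    MvPolynomial (Fin 3) R :=
  Matrix.det (Matrix.of fun i j => pderiv i (pderiv j f))

/-- The exponent vectors of the ten monomials of a ternary cubic form. -/
def expo : Fin 10 → Fin 3 → ℕ :=
  ![![3,0,0], ![0,3,0], ![0,0,3], ![2,1,0], ![2,0,1],
    ![1,2,0], ![0,2,1], ![1,0,2], ![0,1,2], ![1,1,1]]

/-- The ternary cubic form with coefficient vector `c : Fin 10 → R`. -/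
noncomputable def cubic {R : Type*} [CommRing R] (c : Fin 10 → R) : MvPolynomial (Fin 3) R :=
  ∑ k : Fin 10, C (c k) * ∏ i : Fin 3, X i ^ expo k i

/-- The coefficient vector of the Weierstrass cubic `x³ + A·x·z² + B·z³ − y²·z`. -/
noncomputable def wcoeffs {R : Type*} [CommRing R] (A B : R) : Fin 10 → R :=
  ![1, 0, B, 0, 0, 0, -1, A, 0, 0]

/-- The generic ternary cubic form, whose coefficients are the 10 indeterminates. -/
noncomputable def genCubic (R : Type*) [CommRing R] :
    MvPolynomial (Fin 3) (MvPolynomial (Fin 10) R) :=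
  cubic (fun k => X k)

/-- `P` and `Q` are the invariants `I` and `J`: they are homogeneous of degrees 4 and 6
in the ten coefficients, they satisfy the identity
`H(H(f)) = 12288·I(f)²·f + 512·J(f)·H(f)` (stated for the generic ternary cubic form,
hence for every ternary cubic form over every commutative `R`-algebra), and they are
normalized so that `x³ + A·x·z² + B·z³ − y²·z` has `I = −3A` and `J = −27B`. -/
def IsInvariantPair (R : Type*) [CommRing R] (P Q : MvPolynomial (Fin 10) R) : Prop :=
  P.IsHomogeneous 4 ∧ Q.IsHomogeneous 6 ∧
  hess (hess (genCubic R)) =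
    12288 * C P ^ 2 * genCubic R + 512 * C Q * hess (genCubic R) ∧
  ∀ A B : R, aeval (wcoeffs A B) P = -3 * A ∧ aeval (wcoeffs A B) Q = -27 * B

/-- Coefficient vector of the Hessian of `cubic c`. -/
def hc {R : Type*} [CommRing R] (c : Fin 10 → R) : Fin 10 → R :=
  ![2 * (12 * c 0 * c 5 * c 7 - 3 * c 0 * c 9 ^ 2 - 4 * c 3 ^ 2 * c 7 + 4 * c 3 * c 4 * c 9 -
    4 * c 4 ^ 2 * c 5),
    2 * (12 * c 1 * c 3 * c 8 - 3 * c 1 * c 9 ^ 2 - 4 * c 3 * c 6 ^ 2 - 4 * c 5 ^ 2 * c 8 + 4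
    * c 5 * c 6 * c 9),
    2 * (12 * c 2 * c 4 * c 6 - 3 * c 2 * c 9 ^ 2 - 4 * c 4 * c 8 ^ 2 - 4 * c 6 * c 7 ^ 2 + 4
    * c 7 * c 8 * c 9),
    2 * (36 * c 0 * c 1 * c 7 + 12 * c 0 * c 5 * c 8 - 12 * c 0 * c 6 * c 9 - 12 * c 1 * c 4 ^
    2 - 4 * c 3 ^ 2 * c 8 + 8 * c 3 * c 4 * c 6 - 4 * c 3 * c 5 * c 7 + c 3 * c 9 ^ 2),
    2 * (36 * c 0 * c 2 * c 5 + 12 * c 0 * c 6 * c 7 - 12 * c 0 * c 8 * c 9 - 12 * c 2 * c 3 ^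
    2 + 8 * c 3 * c 4 * c 8 - 4 * c 4 ^ 2 * c 6 - 4 * c 4 * c 5 * c 7 + c 4 * c 9 ^ 2),
    2 * (36 * c 0 * c 1 * c 8 - 12 * c 0 * c 6 ^ 2 + 12 * c 1 * c 3 * c 7 - 12 * c 1 * c 4 * c
    9 - 4 * c 3 * c 5 * c 8 + 8 * c 4 * c 5 * c 6 - 4 * c 5 ^ 2 * c 7 + c 5 * c 9 ^ 2),
    2 * (36 * c 1 * c 2 * c 3 + 12 * c 1 * c 4 * c 8 - 12 * c 1 * c 7 * c 9 - 12 * c 2 * c 5 ^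
    2 - 4 * c 3 * c 6 * c 8 - 4 * c 4 * c 6 ^ 2 + 8 * c 5 * c 6 * c 7 + c 6 * c 9 ^ 2),
    2 * (36 * c 0 * c 2 * c 6 - 12 * c 0 * c 8 ^ 2 - 12 * c 2 * c 3 * c 9 + 12 * c 2 * c 4 * c
    5 + 8 * c 3 * c 7 * c 8 - 4 * c 4 * c 6 * c 7 - 4 * c 5 * c 7 ^ 2 + c 7 * c 9 ^ 2),
    2 * (36 * c 1 * c 2 * c 4 - 12 * c 1 * c 7 ^ 2 + 12 * c 2 * c 3 * c 6 - 12 * c 2 * c 5 * c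
    9 - 4 * c 3 * c 8 ^ 2 - 4 * c 4 * c 6 * c 8 + 8 * c 5 * c 7 * c 8 + c 8 * c 9 ^ 2),
    2 * (108 * c 0 * c 1 * c 2 - 12 * c 0 * c 6 * c 8 - 12 * c 1 * c 4 * c 7 - 12 * c 2 * c 3
    * c 5 + 12 * c 3 * c 6 * c 7 - 4 * c 3 * c 8 * c 9 + 12 * c 4 * c 5 * c 8 - 4 * c 4 * c 6
    * c 9 - 4 * c 5 * c 7 * c 9 + c 9 ^ 3)]

/-- Sixteen times the quartic invariant. -/
def S16 {R : Type*} [CommRing R] (c : Fin 10 → R) : R :=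
    -216 * c 0 * c 1 * c 2 * c 9 + 144 * c 0 * c 1 * c 7 * c 8 + 144 * c 0 * c 2 * c 5 * c 6 -
    48 * c 0 * c 5 * c 8 ^ 2 - 48 * c 0 * c 6 ^ 2 * c 7 + 24 * c 0 * c 6 * c 8 * c 9 + 144 * c
    1 * c 2 * c 3 * c 4 - 48 * c 1 * c 3 * c 7 ^ 2 - 48 * c 1 * c 4 ^ 2 * c 8 + 24 * c 1 * c 4
    * c 7 * c 9 - 48 * c 2 * c 3 ^ 2 * c 6 + 24 * c 2 * c 3 * c 5 * c 9 - 48 * c 2 * c 4 * c 5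
    ^ 2 + 16 * c 3 ^ 2 * c 8 ^ 2 - 16 * c 3 * c 4 * c 6 * c 8 - 16 * c 3 * c 5 * c 7 * c 8 +
    24 * c 3 * c 6 * c 7 * c 9 - 8 * c 3 * c 8 * c 9 ^ 2 + 16 * c 4 ^ 2 * c 6 ^ 2 - 16 * c 4 *
    c 5 * c 6 * c 7 + 24 * c 4 * c 5 * c 8 * c 9 - 8 * c 4 * c 6 * c 9 ^ 2 + 16 * c 5 ^ 2 * c
    7 ^ 2 - 8 * c 5 * c 7 * c 9 ^ 2 + c 9 ^ 4

/-- Thirty-two times the sextic invariant. -/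
def T32 {R : Type*} [CommRing R] (c : Fin 10 → R) : R :=
    5832 * c 0 ^ 2 * c 1 ^ 2 * c 2 ^ 2 - 3888 * c 0 ^ 2 * c 1 * c 2 * c 6 * c 8 + 864 * c 0 ^
    2 * c 1 * c 8 ^ 3 + 864 * c 0 ^ 2 * c 2 * c 6 ^ 3 - 216 * c 0 ^ 2 * c 6 ^ 2 * c 8 ^ 2 -
    3888 * c 0 * c 1 ^ 2 * c 2 * c 4 * c 7 + 864 * c 0 * c 1 ^ 2 * c 7 ^ 3 - 3888 * c 0 * c 1
    * c 2 ^ 2 * c 3 * c 5 + 1296 * c 0 * c 1 * c 2 * c 3 * c 6 * c 7 + 1296 * c 0 * c 1 * c 2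
    * c 3 * c 8 * c 9 + 1296 * c 0 * c 1 * c 2 * c 4 * c 5 * c 8 + 1296 * c 0 * c 1 * c 2 * c
    4 * c 6 * c 9 + 1296 * c 0 * c 1 * c 2 * c 5 * c 7 * c 9 - 540 * c 0 * c 1 * c 2 * c 9 ^ 3
    - 864 * c 0 * c 1 * c 3 * c 7 * c 8 ^ 2 + 1296 * c 0 * c 1 * c 4 * c 6 * c 7 * c 8 - 864 *
    c 0 * c 1 * c 4 * c 8 ^ 2 * c 9 - 864 * c 0 * c 1 * c 5 * c 7 ^ 2 * c 8 - 864 * c 0 * c 1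
    * c 6 * c 7 ^ 2 * c 9 + 648 * c 0 * c 1 * c 7 * c 8 * c 9 ^ 2 + 864 * c 0 * c 2 ^ 2 * c 5
    ^ 3 + 1296 * c 0 * c 2 * c 3 * c 5 * c 6 * c 8 - 864 * c 0 * c 2 * c 3 * c 6 ^ 2 * c 9 -
    864 * c 0 * c 2 * c 4 * c 5 * c 6 ^ 2 - 864 * c 0 * c 2 * c 5 ^ 2 * c 6 * c 7 - 864 * c 0
    * c 2 * c 5 ^ 2 * c 8 * c 9 + 648 * c 0 * c 2 * c 5 * c 6 * c 9 ^ 2 - 288 * c 0 * c 3 * c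
    5 * c 8 ^ 3 + 144 * c 0 * c 3 * c 6 ^ 2 * c 7 * c 8 + 144 * c 0 * c 3 * c 6 * c 8 ^ 2 * c
    9 + 144 * c 0 * c 4 * c 5 * c 6 * c 8 ^ 2 - 288 * c 0 * c 4 * c 6 ^ 3 * c 7 + 144 * c 0 *
    c 4 * c 6 ^ 2 * c 8 * c 9 + 576 * c 0 * c 5 ^ 2 * c 7 * c 8 ^ 2 + 576 * c 0 * c 5 * c 6 ^
    2 * c 7 ^ 2 - 720 * c 0 * c 5 * c 6 * c 7 * c 8 * c 9 + 72 * c 0 * c 5 * c 8 ^ 2 * c 9 ^ 2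
    + 72 * c 0 * c 6 ^ 2 * c 7 * c 9 ^ 2 - 36 * c 0 * c 6 * c 8 * c 9 ^ 3 + 864 * c 1 ^ 2 * c
    2 * c 4 ^ 3 - 216 * c 1 ^ 2 * c 4 ^ 2 * c 7 ^ 2 + 864 * c 1 * c 2 ^ 2 * c 3 ^ 3 - 864 * c
    1 * c 2 * c 3 ^ 2 * c 4 * c 8 - 864 * c 1 * c 2 * c 3 ^ 2 * c 7 * c 9 - 864 * c 1 * c 2 *
    c 3 * c 4 ^ 2 * c 6 + 1296 * c 1 * c 2 * c 3 * c 4 * c 5 * c 7 + 648 * c 1 * c 2 * c 3 * c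
    4 * c 9 ^ 2 - 864 * c 1 * c 2 * c 4 ^ 2 * c 5 * c 9 + 576 * c 1 * c 3 ^ 2 * c 7 ^ 2 * c 8
    + 576 * c 1 * c 3 * c 4 ^ 2 * c 8 ^ 2 + 144 * c 1 * c 3 * c 4 * c 6 * c 7 ^ 2 - 720 * c 1
    * c 3 * c 4 * c 7 * c 8 * c 9 - 288 * c 1 * c 3 * c 5 * c 7 ^ 3 + 72 * c 1 * c 3 * c 7 ^ 2
    * c 9 ^ 2 - 288 * c 1 * c 4 ^ 3 * c 6 * c 8 + 144 * c 1 * c 4 ^ 2 * c 5 * c 7 * c 8 + 144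
    * c 1 * c 4 ^ 2 * c 6 * c 7 * c 9 + 72 * c 1 * c 4 ^ 2 * c 8 * c 9 ^ 2 + 144 * c 1 * c 4 *
    c 5 * c 7 ^ 2 * c 9 - 36 * c 1 * c 4 * c 7 * c 9 ^ 3 - 216 * c 2 ^ 2 * c 3 ^ 2 * c 5 ^ 2 -
    288 * c 2 * c 3 ^ 3 * c 6 * c 8 + 576 * c 2 * c 3 ^ 2 * c 4 * c 6 ^ 2 + 144 * c 2 * c 3 ^
    2 * c 5 * c 6 * c 7 + 144 * c 2 * c 3 ^ 2 * c 5 * c 8 * c 9 + 72 * c 2 * c 3 ^ 2 * c 6 * c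
    9 ^ 2 + 144 * c 2 * c 3 * c 4 * c 5 ^ 2 * c 8 - 720 * c 2 * c 3 * c 4 * c 5 * c 6 * c 9 +
    144 * c 2 * c 3 * c 5 ^ 2 * c 7 * c 9 - 36 * c 2 * c 3 * c 5 * c 9 ^ 3 + 576 * c 2 * c 4 ^
    2 * c 5 ^ 2 * c 6 - 288 * c 2 * c 4 * c 5 ^ 3 * c 7 + 72 * c 2 * c 4 * c 5 ^ 2 * c 9 ^ 2 +
    64 * c 3 ^ 3 * c 8 ^ 3 - 96 * c 3 ^ 2 * c 4 * c 6 * c 8 ^ 2 - 96 * c 3 ^ 2 * c 5 * c 7 * c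
    8 ^ 2 - 216 * c 3 ^ 2 * c 6 ^ 2 * c 7 ^ 2 + 144 * c 3 ^ 2 * c 6 * c 7 * c 8 * c 9 - 48 * c
    3 ^ 2 * c 8 ^ 2 * c 9 ^ 2 - 96 * c 3 * c 4 ^ 2 * c 6 ^ 2 * c 8 - 48 * c 3 * c 4 * c 5 * c
    6 * c 7 * c 8 + 144 * c 3 * c 4 * c 5 * c 8 ^ 2 * c 9 + 144 * c 3 * c 4 * c 6 ^ 2 * c 7 *
    c 9 - 24 * c 3 * c 4 * c 6 * c 8 * c 9 ^ 2 - 96 * c 3 * c 5 ^ 2 * c 7 ^ 2 * c 8 + 144 * c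
    3 * c 5 * c 6 * c 7 ^ 2 * c 9 - 24 * c 3 * c 5 * c 7 * c 8 * c 9 ^ 2 - 36 * c 3 * c 6 * c
    7 * c 9 ^ 3 + 12 * c 3 * c 8 * c 9 ^ 4 + 64 * c 4 ^ 3 * c 6 ^ 3 - 216 * c 4 ^ 2 * c 5 ^ 2
    * c 8 ^ 2 - 96 * c 4 ^ 2 * c 5 * c 6 ^ 2 * c 7 + 144 * c 4 ^ 2 * c 5 * c 6 * c 8 * c 9 -
    48 * c 4 ^ 2 * c 6 ^ 2 * c 9 ^ 2 - 96 * c 4 * c 5 ^ 2 * c 6 * c 7 ^ 2 + 144 * c 4 * c 5 ^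
    2 * c 7 * c 8 * c 9 - 24 * c 4 * c 5 * c 6 * c 7 * c 9 ^ 2 - 36 * c 4 * c 5 * c 8 * c 9 ^
    3 + 12 * c 4 * c 6 * c 9 ^ 4 + 64 * c 5 ^ 3 * c 7 ^ 3 - 48 * c 5 ^ 2 * c 7 ^ 2 * c 9 ^ 2 +
    12 * c 5 * c 7 * c 9 ^ 4 - c 9 ^ 6

/-- Coefficients after the substitution `x ↦ x + t y`. -/
def mvxy {R : Type*} [CommRing R] (t : R) (c : Fin 10 → R) : Fin 10 → R :=
    ![c 0, c 1 + t * c 5 + t ^ 2 * c 3 + t ^ 3 * c 0, c 2, c 3 + 3 * t * c 0, c 4, c 5 + 2 * t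
    * c 3 + 3 * t ^ 2 * c 0, c 6 + t * c 9 + t ^ 2 * c 4, c 7, c 8 + t * c 7, c 9 + 2 * t * c
    4]

/-- Coefficients after the substitution `x ↦ x + t z`. -/
def mvxz {R : Type*} [CommRing R] (t : R) (c : Fin 10 → R) : Fin 10 → R :=
    ![c 0, c 1, c 2 + t * c 7 + t ^ 2 * c 4 + t ^ 3 * c 0, c 3, c 4 + 3 * t * c 0, c 5, c 6 +
    t * c 5, c 7 + 2 * t * c 4 + 3 * t ^ 2 * c 0, c 8 + t * c 9 + t ^ 2 * c 3, c 9 + 2 * t * c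
    3]

/-- Coefficients after the substitution `y ↦ y + t x`. -/
def mvyx {R : Type*} [CommRing R] (t : R) (c : Fin 10 → R) : Fin 10 → R :=
    ![c 0 + t * c 3 + t ^ 2 * c 5 + t ^ 3 * c 1, c 1, c 2, c 3 + 2 * t * c 5 + 3 * t ^ 2 * c
    1, c 4 + t * c 9 + t ^ 2 * c 6, c 5 + 3 * t * c 1, c 6, c 7 + t * c 8, c 8, c 9 + 2 * t *
    c 6]

/-- Coefficients after the substitution `y ↦ y + t z`. -/
def mvyz {R : Type*} [CommRing R] (t : R) (c : Fin 10 → R) : Fin 10 → R :=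
    ![c 0, c 1, c 2 + t * c 8 + t ^ 2 * c 6 + t ^ 3 * c 1, c 3, c 4 + t * c 3, c 5, c 6 + 3 *
    t * c 1, c 7 + t * c 9 + t ^ 2 * c 5, c 8 + 2 * t * c 6 + 3 * t ^ 2 * c 1, c 9 + 2 * t * c
    5]

/-- Coefficients after the substitution `z ↦ z + t x`. -/
def mvzx {R : Type*} [CommRing R] (t : R) (c : Fin 10 → R) : Fin 10 → R :=
    ![c 0 + t * c 4 + t ^ 2 * c 7 + t ^ 3 * c 2, c 1, c 2, c 3 + t * c 9 + t ^ 2 * c 8, c 4 +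
    2 * t * c 7 + 3 * t ^ 2 * c 2, c 5 + t * c 6, c 6, c 7 + 3 * t * c 2, c 8, c 9 + 2 * t * c
    8]

/-- Coefficients after the substitution `z ↦ z + t y`. -/
def mvzy {R : Type*} [CommRing R] (t : R) (c : Fin 10 → R) : Fin 10 → R :=
    ![c 0, c 1 + t * c 6 + t ^ 2 * c 8 + t ^ 3 * c 2, c 2, c 3 + t * c 4, c 4, c 5 + t * c 9 +
    t ^ 2 * c 7, c 6 + 2 * t * c 8 + 3 * t ^ 2 * c 2, c 7, c 8 + 3 * t * c 2, c 9 + 2 * t * c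
    7]

theorem cubic_eq {R : Type*} [CommRing R] (c : Fin 10 → R) :
    cubic c = C (c 0) * X 0 ^ 3 + C (c 1) * X 1 ^ 3 + C (c 2) * X 2 ^ 3
      + C (c 3) * (X 0 ^ 2 * X 1) + C (c 4) * (X 0 ^ 2 * X 2) + C (c 5) * (X 0 * X 1 ^ 2)
      + C (c 6) * (X 1 ^ 2 * X 2) + C (c 7) * (X 0 * X 2 ^ 2) + C (c 8) * (X 1 * X 2 ^ 2)
      + C (c 9) * (X 0 * X 1 * X 2) := by
  have e : ∀ k : Fin 10, (∏ i : Fin 3, (X i : MvPolynomial (Fin 3) R) ^ expo k i)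
      = X 0 ^ expo k 0 * X 1 ^ expo k 1 * X 2 ^ expo k 2 := fun k => Fin.prod_univ_three _
  have s : ∀ F : Fin 10 → MvPolynomial (Fin 3) R, ∑ k, F k
      = F 0 + F 1 + F 2 + F 3 + F 4 + F 5 + F 6 + F 7 + F 8 + F 9 := fun F => by
    simp only [Fin.sum_univ_succ, Fin.sum_univ_zero]
    simp [Fin.succ]
    ring
  rw [cubic, s]
  simp only [e]
  simp [expo]

theorem pd_two {R : Type*} [CommRing R] (i : Fin 3) :
    pderiv i (2 : MvPolynomial (Fin 3) R) = 0 := by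
  rw [← map_ofNat C 2]
  exact pderiv_C

theorem pd_three {R : Type*} [CommRing R] (i : Fin 3) :
    pderiv i (3 : MvPolynomial (Fin 3) R) = 0 := by
  rw [← map_ofNat C 3]
  exact pderiv_C

theorem pd0 {R : Type*} [CommRing R] (c : Fin 10 → R) :
    pderiv 0 (cubic c) = 3 * C (c 0) * X 0 ^ 2 + 2 * C (c 3) * X 0 * X 1 + 2 * C (c 4) * X 0 * X 2 + C (c 5) * X 1 ^ 2 + C (c 7) * X 2 ^ 2 + C (c 9) * X 1 * X 2 := by
  rw [cubic_eq]
  simp [Derivation.leibniz, Derivation.leibniz_pow, pderiv_X]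
  ring

theorem pd1 {R : Type*} [CommRing R] (c : Fin 10 → R) :
    pderiv 1 (cubic c) = 3 * C (c 1) * X 1 ^ 2 + C (c 3) * X 0 ^ 2 + 2 * C (c 5) * X 0 * X 1 + 2 * C (c 6) * X 1 * X 2 + C (c 8) * X 2 ^ 2 + C (c 9) * X 0 * X 2 := by
  rw [cubic_eq]
  simp [Derivation.leibniz, Derivation.leibniz_pow, pderiv_X]
  ring

theorem pd2 {R : Type*} [CommRing R] (c : Fin 10 → R) :
    pderiv 2 (cubic c) = 3 * C (c 2) * X 2 ^ 2 + C (c 4) * X 0 ^ 2 + C (c 6) * X 1 ^ 2 + 2 * C (c 7) * X 0 * X 2 + 2 * C (c 8) * X 1 * X 2 + C (c 9) * X 0 * X 1 := by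
  rw [cubic_eq]
  simp [Derivation.leibniz, Derivation.leibniz_pow, pderiv_X]
  ring

theorem pd00 {R : Type*} [CommRing R] (c : Fin 10 → R) :
    pderiv 0 (pderiv 0 (cubic c)) = 6 * C (c 0) * X 0 + 2 * C (c 3) * X 1 + 2 * C (c 4) * X 2 := by
  rw [pd0]
  simp [pd_two, pd_three, Derivation.leibniz, Derivation.leibniz_pow, pderiv_X]
  try ring

theorem pd10 {R : Type*} [CommRing R] (c : Fin 10 → R) :
    pderiv 1 (pderiv 0 (cubic c)) = 2 * C (c 3) * X 0 + 2 * C (c 5) * X 1 + C (c 9) * X 2 := by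
  rw [pd0]
  simp [pd_two, pd_three, Derivation.leibniz, Derivation.leibniz_pow, pderiv_X]
  try ring

theorem pd20 {R : Type*} [CommRing R] (c : Fin 10 → R) :
    pderiv 2 (pderiv 0 (cubic c)) = 2 * C (c 4) * X 0 + 2 * C (c 7) * X 2 + C (c 9) * X 1 := by
  rw [pd0]
  simp [pd_two, pd_three, Derivation.leibniz, Derivation.leibniz_pow, pderiv_X]
  try ring

theorem pd01 {R : Type*} [CommRing R] (c : Fin 10 → R) :
    pderiv 0 (pderiv 1 (cubic c)) = 2 * C (c 3) * X 0 + 2 * C (c 5) * X 1 + C (c 9) * X 2 := by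
  rw [pd1]
  simp [pd_two, pd_three, Derivation.leibniz, Derivation.leibniz_pow, pderiv_X]
  try ring

theorem pd11 {R : Type*} [CommRing R] (c : Fin 10 → R) :
    pderiv 1 (pderiv 1 (cubic c)) = 6 * C (c 1) * X 1 + 2 * C (c 5) * X 0 + 2 * C (c 6) * X 2 := by
  rw [pd1]
  simp [pd_two, pd_three, Derivation.leibniz, Derivation.leibniz_pow, pderiv_X]
  try ring

theorem pd21 {R : Type*} [CommRing R] (c : Fin 10 → R) :
    pderiv 2 (pderiv 1 (cubic c)) = 2 * C (c 6) * X 1 + 2 * C (c 8) * X 2 + C (c 9) * X 0 := by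
  rw [pd1]
  simp [pd_two, pd_three, Derivation.leibniz, Derivation.leibniz_pow, pderiv_X]
  try ring

theorem pd02 {R : Type*} [CommRing R] (c : Fin 10 → R) :
    pderiv 0 (pderiv 2 (cubic c)) = 2 * C (c 4) * X 0 + 2 * C (c 7) * X 2 + C (c 9) * X 1 := by
  rw [pd2]
  simp [pd_two, pd_three, Derivation.leibniz, Derivation.leibniz_pow, pderiv_X]
  try ring

theorem pd12 {R : Type*} [CommRing R] (c : Fin 10 → R) :
    pderiv 1 (pderiv 2 (cubic c)) = 2 * C (c 6) * X 1 + 2 * C (c 8) * X 2 + C (c 9) * X 0 := by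
  rw [pd2]
  simp [pd_two, pd_three, Derivation.leibniz, Derivation.leibniz_pow, pderiv_X]
  try ring

theorem pd22 {R : Type*} [CommRing R] (c : Fin 10 → R) :
    pderiv 2 (pderiv 2 (cubic c)) = 6 * C (c 2) * X 2 + 2 * C (c 7) * X 0 + 2 * C (c 8) * X 1 := by
  rw [pd2]
  simp [pd_two, pd_three, Derivation.leibniz, Derivation.leibniz_pow, pderiv_X]
  try ring

theorem hess_cubic {R : Type*} [CommRing R] (c : Fin 10 → R) :
    hess (cubic c) = cubic (hc c) := by
  rw [hess, Matrix.det_fin_three, cubic_eq (hc c)]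
  simp only [Matrix.of_apply, pd00, pd01, pd02, pd10, pd11, pd12, pd20, pd21, pd22]
  simp only [hc, Matrix.cons_val, map_mul, map_add, map_sub, map_pow, map_ofNat]
  ring

theorem hess_hess_zero {R : Type*} [CommRing R] (c : Fin 10 → R) :
    hc (hc c) 0 = 48 * S16 c ^ 2 * c 0 + 16 * T32 c * hc c 0 := by
  simp [hc, S16, T32]
  ring

theorem hess_hess_one {R : Type*} [CommRing R] (c : Fin 10 → R) :
    hc (hc c) 1 = 48 * S16 c ^ 2 * c 1 + 16 * T32 c * hc c 1 := by
  simp [hc, S16, T32]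
  ring

/-- Two odd continuous functions on the sphere have a common zero. -/
theorem borsuk_ulam_two (F : (Fin 3 → ℝ) → ℝ) (G : (Fin 3 → ℝ) → ℝ)
    (hF : Continuous F) (hG : Continuous G) (oF : ∀ v, F (-v) = -F v) (oG : ∀ v, G (-v) = -G v) :
    ∃ v : Fin 3 → ℝ, v ≠ 0 ∧ F v = 0 ∧ G v = 0 := by
  by_contra! hcon
  let σ : ℝ × ℝ → (Fin 3 → ℝ) := fun p =>
    ![Real.cos p.1 * Real.cos p.2, Real.sin p.1 * Real.cos p.2, Real.sin p.2]
  have hσc : Continuous σ := by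
    refine continuous_pi fun i => ?_
    fin_cases i <;> simp [σ] <;> fun_prop
  have hσ0 : ∀ p, σ p ≠ 0 := by
    intro p h
    have h0 : Real.cos p.1 * Real.cos p.2 = 0 := by simpa [σ] using congrFun h 0
    have h1 : Real.sin p.1 * Real.cos p.2 = 0 := by simpa [σ] using congrFun h 1
    have h2 : Real.sin p.2 = 0 := by simpa [σ] using congrFun h 2
    have a := Real.sin_sq_add_cos_sq p.1
    have b := Real.sin_sq_add_cos_sq p.2
    rw [h2] at b
    have : Real.cos p.2 ^ 2 = (Real.cos p.1 * Real.cos p.2) ^ 2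
      + (Real.sin p.1 * Real.cos p.2) ^ 2 := by
      linear_combination (-Real.cos p.2 ^ 2) * a
    rw [h0, h1] at this
    nlinarith
  have hσa : ∀ a b, σ (a + Real.pi, -b) = -σ (a, b) := by
    intro a b
    ext i
    fin_cases i <;> simp [σ]
  have hσp : ∀ a, σ (a, Real.pi / 2) = σ (0, Real.pi / 2) := by
    intro a
    ext i
    fin_cases i <;> simp [σ]
  let h : C(ℝ × ℝ, ℂ) := ⟨fun p => (F (σ p) : ℂ) + (G (σ p) : ℂ) * Complex.I, by fun_prop⟩
  have hdef : ∀ p, h p = (F (σ p) : ℂ) + (G (σ p) : ℂ) * Complex.I := fun _ => rfl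
  have h0 : ∀ p, h p ≠ 0 := by
    intro p e
    rw [hdef] at e
    have e1 : F (σ p) = 0 := by simpa using congrArg Complex.re e
    have e2 : G (σ p) = 0 := by simpa using congrArg Complex.im e
    exact hcon _ (hσ0 p) e1 e2
  obtain ⟨L, ⟨-, hL⟩, -⟩ := Complex.isCoveringMapOn_exp.existsUnique_continuousMap_lifts
    h (a₀ := (0, 0)) (Complex.exp_log (h0 _)) h0
  have hL' : ∀ p, Complex.exp (L p) = h p := fun p => congrFun hL p
  -- a continuous function with values in a lattice of periods is constant
  have key : ∀ u : ℝ → ℂ, Continuous u → (∀ a, Complex.exp (u a) = Complex.exp (u 0)) →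
      ∀ a, u a = u 0 := by
    intro u hu he a
    have hn : ∀ a, ∃ n : ℤ, u a = u 0 + n * (2 * Real.pi * Complex.I) := fun a =>
      Complex.exp_eq_exp_iff_exists_int.1 (he a)
    choose n hn using hn
    have hpi : (2 * Real.pi : ℝ) ≠ 0 := by positivity
    have hnr : ∀ a, (n a : ℝ) = ((u a).im - (u 0).im) / (2 * Real.pi) := by
      intro a
      have := congrArg Complex.im (hn a)
      simp at this
      rw [this]
      field_simp
      ring
    have hc : Continuous fun a => (n a : ℝ) := by
      simp only [hnr]
      fun_prop
    have hc' : Continuous n := Int.isClosedEmbedding_coe_real.isEmbedding.continuous_iff.2 hc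
    have hna : n a = n 0 := PreconnectedSpace.constant inferInstance hc'
    have h00 := hn 0
    have h1 := hn a
    rw [hna] at h1
    rw [h1, ← h00]
  have hpole : L (2 * Real.pi, Real.pi / 2) = L (0, Real.pi / 2) :=
    key (fun a => L (a, Real.pi / 2)) (by fun_prop) (fun a => by
      simp only [hL', hdef, hσp a]) _
  have hanti : ∀ p : ℝ × ℝ, h (p.1 + Real.pi, -p.2) = -h p := by
    intro p
    simp only [hdef, hσa, oF, oG]
    push_cast
    ring
  have hconst : ∀ p : ℝ × ℝ, L (p.1 + Real.pi, -p.2) - L p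
      = L (0 + Real.pi, -0) - L (0, 0) := by
    intro p
    have := key (fun t => L (t * p.1 + Real.pi, -(t * p.2)) - L (t * p.1, t * p.2))
      (by fun_prop) (fun t => by
        have e : ∀ q : ℝ × ℝ, Complex.exp (L (q.1 + Real.pi, -q.2) - L q) = -1 := by
          intro q
          rw [Complex.exp_sub, hL', hL', hanti, neg_div, div_self (h0 q)]
        have e1 := e (t * p.1, t * p.2)
        have e2 := e (0 * p.1, 0 * p.2)
        simp only at e1 e2
        rw [e1, e2]) 1
    simpa using this
  have e0 : Complex.exp (L (0 + Real.pi, -0) - L (0, 0)) = -1 := by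
    have := hanti (0, 0)
    simp only at this
    rw [Complex.exp_sub, hL', hL', this, neg_div, div_self (h0 _)]
  have c1 := hconst (0, Real.pi / 2)
  have c2 := hconst (0 + Real.pi, -(Real.pi / 2))
  simp only [neg_neg] at c1 c2
  have e3 : (0 + Real.pi + Real.pi : ℝ) = 2 * Real.pi := by ring
  rw [e3, hpole] at c2
  have : L (0 + Real.pi, -0) - L (0, 0) = 0 := by linear_combination (-c1 - c2) / 2
  rw [this, Complex.exp_zero] at e0
  norm_num at e0

theorem actGL_mul {R : Type*} [CommRing R] (a b : Matrix (Fin 3) (Fin 3) R)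
    (f : MvPolynomial (Fin 3) R) : actGL a (actGL b f) = actGL (a * b) f := by
  unfold actGL
  rw [bind₁_bind₁]
  congr 2
  funext j
  simp only [map_mul, bind₁_X_right, Matrix.mul_apply, algHom_C, algebraMap_eq,
    Fin.sum_univ_three, map_add]
  ring

/-- The conclusion of the theorem. -/
def Good (c : Fin 10 → ℝ) : Prop :=
  ∃ (γ : Matrix.SpecialLinearGroup (Fin 3) ℝ) (A B : ℝ),
    actGL (γ : Matrix (Fin 3) (Fin 3) ℝ) (cubic c) = cubic (wcoeffs A B)

theorem Good.of_move {c c' : Fin 10 → ℝ} (γ : Matrix (Fin 3) (Fin 3) ℝ) (hγ : γ.det = 1)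
    (h : actGL γ (cubic c) = cubic c') (hg : Good c') : Good c := by
  obtain ⟨δ, A, B, hδ⟩ := hg
  refine ⟨δ * ⟨γ, hγ⟩, A, B, ?_⟩
  rw [← hδ, ← h, actGL_mul]
  rfl

/-- The discriminant, up to a constant factor. -/
def Dsc {R : Type*} [CommRing R] (c : Fin 10 → R) : R := S16 c ^ 3 - T32 c ^ 2

theorem Good.of_mvxy {c : Fin 10 → ℝ} (t : ℝ) (h : Good (mvxy t c)) : Good c := by
  refine Good.of_move !![1, 0, 0; t, 1, 0; 0, 0, 1] (by simp [Matrix.det_fin_three]) ?_ h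
  rw [actGL, cubic_eq, cubic_eq]
  simp only [map_add, map_mul, map_pow, bind₁_X_right, algHom_C, algebraMap_eq,
    Fin.sum_univ_three, mvxy, Matrix.cons_val, Matrix.of_apply, map_ofNat, map_one, map_zero]
  ring

theorem Dsc_mvxy {R : Type*} [CommRing R] (t : R) (c : Fin 10 → R) :
    Dsc (mvxy t c) = Dsc c := by
  have h1 : S16 (mvxy t c) = S16 c := by
    simp only [S16, mvxy, Matrix.cons_val]
    ring
  have h2 : T32 (mvxy t c) = T32 c := by
    simp only [T32, mvxy, Matrix.cons_val]
    ring
  rw [Dsc, Dsc, h1, h2]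

theorem Good.of_mvxz {c : Fin 10 → ℝ} (t : ℝ) (h : Good (mvxz t c)) : Good c := by
  refine Good.of_move !![1, 0, 0; 0, 1, 0; t, 0, 1] (by simp [Matrix.det_fin_three]) ?_ h
  rw [actGL, cubic_eq, cubic_eq]
  simp only [map_add, map_mul, map_pow, bind₁_X_right, algHom_C, algebraMap_eq,
    Fin.sum_univ_three, mvxz, Matrix.cons_val, Matrix.of_apply, map_ofNat, map_one, map_zero]
  ring

theorem Dsc_mvxz {R : Type*} [CommRing R] (t : R) (c : Fin 10 → R) :
    Dsc (mvxz t c) = Dsc c := by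
  have h1 : S16 (mvxz t c) = S16 c := by
    simp only [S16, mvxz, Matrix.cons_val]
    ring
  have h2 : T32 (mvxz t c) = T32 c := by
    simp only [T32, mvxz, Matrix.cons_val]
    ring
  rw [Dsc, Dsc, h1, h2]

theorem Good.of_mvyx {c : Fin 10 → ℝ} (t : ℝ) (h : Good (mvyx t c)) : Good c := by
  refine Good.of_move !![1, t, 0; 0, 1, 0; 0, 0, 1] (by simp [Matrix.det_fin_three]) ?_ h
  rw [actGL, cubic_eq, cubic_eq]
  simp only [map_add, map_mul, map_pow, bind₁_X_right, algHom_C, algebraMap_eq,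
    Fin.sum_univ_three, mvyx, Matrix.cons_val, Matrix.of_apply, map_ofNat, map_one, map_zero]
  ring

theorem Dsc_mvyx {R : Type*} [CommRing R] (t : R) (c : Fin 10 → R) :
    Dsc (mvyx t c) = Dsc c := by
  have h1 : S16 (mvyx t c) = S16 c := by
    simp only [S16, mvyx, Matrix.cons_val]
    ring
  have h2 : T32 (mvyx t c) = T32 c := by
    simp only [T32, mvyx, Matrix.cons_val]
    ring
  rw [Dsc, Dsc, h1, h2]

theorem Good.of_mvyz {c : Fin 10 → ℝ} (t : ℝ) (h : Good (mvyz t c)) : Good c := by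
  refine Good.of_move !![1, 0, 0; 0, 1, 0; 0, t, 1] (by simp [Matrix.det_fin_three]) ?_ h
  rw [actGL, cubic_eq, cubic_eq]
  simp only [map_add, map_mul, map_pow, bind₁_X_right, algHom_C, algebraMap_eq,
    Fin.sum_univ_three, mvyz, Matrix.cons_val, Matrix.of_apply, map_ofNat, map_one, map_zero]
  ring

theorem Dsc_mvyz {R : Type*} [CommRing R] (t : R) (c : Fin 10 → R) :
    Dsc (mvyz t c) = Dsc c := by
  have h1 : S16 (mvyz t c) = S16 c := by
    simp only [S16, mvyz, Matrix.cons_val]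
    ring
  have h2 : T32 (mvyz t c) = T32 c := by
    simp only [T32, mvyz, Matrix.cons_val]
    ring
  rw [Dsc, Dsc, h1, h2]

theorem Good.of_mvzx {c : Fin 10 → ℝ} (t : ℝ) (h : Good (mvzx t c)) : Good c := by
  refine Good.of_move !![1, 0, t; 0, 1, 0; 0, 0, 1] (by simp [Matrix.det_fin_three]) ?_ h
  rw [actGL, cubic_eq, cubic_eq]
  simp only [map_add, map_mul, map_pow, bind₁_X_right, algHom_C, algebraMap_eq,
    Fin.sum_univ_three, mvzx, Matrix.cons_val, Matrix.of_apply, map_ofNat, map_one, map_zero]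
  ring

theorem Dsc_mvzx {R : Type*} [CommRing R] (t : R) (c : Fin 10 → R) :
    Dsc (mvzx t c) = Dsc c := by
  have h1 : S16 (mvzx t c) = S16 c := by
    simp only [S16, mvzx, Matrix.cons_val]
    ring
  have h2 : T32 (mvzx t c) = T32 c := by
    simp only [T32, mvzx, Matrix.cons_val]
    ring
  rw [Dsc, Dsc, h1, h2]

theorem Good.of_mvzy {c : Fin 10 → ℝ} (t : ℝ) (h : Good (mvzy t c)) : Good c := by
  refine Good.of_move !![1, 0, 0; 0, 1, t; 0, 0, 1] (by simp [Matrix.det_fin_three]) ?_ h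
  rw [actGL, cubic_eq, cubic_eq]
  simp only [map_add, map_mul, map_pow, bind₁_X_right, algHom_C, algebraMap_eq,
    Fin.sum_univ_three, mvzy, Matrix.cons_val, Matrix.of_apply, map_ofNat, map_one, map_zero]
  ring

theorem Dsc_mvzy {R : Type*} [CommRing R] (t : R) (c : Fin 10 → R) :
    Dsc (mvzy t c) = Dsc c := by
  have h1 : S16 (mvzy t c) = S16 c := by
    simp only [S16, mvzy, Matrix.cons_val]
    ring
  have h2 : T32 (mvzy t c) = T32 c := by
    simp only [T32, mvzy, Matrix.cons_val]
    ring
  rw [Dsc, Dsc, h1, h2]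


/-- Value of the cubic form at a real point. -/
def ev (c : Fin 10 → ℝ) (x y z : ℝ) : ℝ :=
  c 0 * x ^ 3 + c 1 * y ^ 3 + c 2 * z ^ 3 + c 3 * (x ^ 2 * y) + c 4 * (x ^ 2 * z)
    + c 5 * (x * y ^ 2) + c 6 * (y ^ 2 * z) + c 7 * (x * z ^ 2) + c 8 * (y * z ^ 2)
    + c 9 * (x * y * z)

theorem exists_cube_root (a : ℝ) : ∃ l : ℝ, l ^ 3 = a := by
  rcases le_total 0 a with h | h
  · exact ⟨a ^ ((3 : ℕ) : ℝ)⁻¹, Real.rpow_inv_natCast_pow h (by norm_num)⟩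
  · refine ⟨-(-a) ^ ((3 : ℕ) : ℝ)⁻¹, ?_⟩
    rw [Odd.neg_pow (by decide), Real.rpow_inv_natCast_pow (neg_nonneg.2 h) (by norm_num),
      neg_neg]

theorem good_scale (c : Fin 10 → ℝ) (h1 : c 1 = 0) (h3 : c 3 = 0) (h4 : c 4 = 0) (h5 : c 5 = 0)
    (h8 : c 8 = 0) (h9 : c 9 = 0) (h0 : c 0 ≠ 0) (h6 : c 6 ≠ 0) : Good c := by
  obtain ⟨l, hl⟩ : ∃ l : ℝ, l ^ 3 = 1 / c 0 :=
    exists_cube_root _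
  have hl0 : l ≠ 0 := by
    rintro rfl
    have : (1 / c 0) ≠ 0 := by positivity
    exact this (by rw [← hl]; norm_num)
  let m : ℝ := -l / c 6
  let n : ℝ := 1 / (l * m)
  have hm0 : m ≠ 0 := div_ne_zero (neg_ne_zero.2 hl0) h6
  have e0 : c 0 * l ^ 3 = 1 := by rw [hl]; field_simp
  have e6 : c 6 * (m ^ 2 * n) = -1 := by
    simp only [n, m]
    field_simp
  refine ⟨⟨!![l, 0, 0; 0, m, 0; 0, 0, n], ?_⟩, c 7 * (l * n ^ 2), c 2 * n ^ 3, ?_⟩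
  · simp only [Matrix.det_fin_three, Matrix.of_apply, Matrix.cons_val]
    simp only [n]
    field_simp
    ring
  · rw [actGL, cubic_eq, cubic_eq]
    simp only [h1, h3, h4, h5, h8, h9, map_add, map_mul, map_pow, bind₁_X_right, algHom_C,
      algebraMap_eq, Fin.sum_univ_three, wcoeffs, Matrix.cons_val, Matrix.of_apply, map_zero,
      map_one, map_neg]
    have E0 : (C (c 0) * C l ^ 3 : MvPolynomial (Fin 3) ℝ) = 1 := by
      rw [← map_pow, ← map_mul, e0, map_one]
    have E6 : (C (c 6) * (C m ^ 2 * C n) : MvPolynomial (Fin 3) ℝ) = -1 := by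
      rw [← map_pow, ← map_mul, ← map_mul, e6, map_neg, map_one]
    linear_combination X 0 ^ 3 * E0 + X 1 ^ 2 * X 2 * E6

theorem good_four (c : Fin 10 → ℝ) (h1 : c 1 = 0) (h3 : c 3 = 0) (h5 : c 5 = 0)
    (h8 : c 8 = 0) (h9 : c 9 = 0) (h0 : c 0 ≠ 0) (h6 : c 6 ≠ 0) : Good c := by
  refine Good.of_mvxz (-c 4 / (3 * c 0)) (good_scale _ ?_ ?_ ?_ ?_ ?_ ?_ ?_ ?_) <;>
    simp [mvxz, h1, h3, h5, h8, h9, h0, h6]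
  field_simp
  ring

theorem good_eight (c : Fin 10 → ℝ) (h1 : c 1 = 0) (h3 : c 3 = 0) (h5 : c 5 = 0)
    (h9 : c 9 = 0) (h0 : c 0 ≠ 0) (h6 : c 6 ≠ 0) : Good c := by
  refine Good.of_mvyz (-c 8 / (2 * c 6)) (good_four _ ?_ ?_ ?_ ?_ ?_ ?_ ?_) <;>
    simp [mvyz, h1, h3, h5, h9, h0, h6]
  field_simp
  ring

theorem good_nine (c : Fin 10 → ℝ) (h1 : c 1 = 0) (h3 : c 3 = 0) (h5 : c 5 = 0)
    (h0 : c 0 ≠ 0) (h6 : c 6 ≠ 0) : Good c := by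
  refine Good.of_mvyx (-c 9 / (2 * c 6)) (good_eight _ ?_ ?_ ?_ ?_ ?_ ?_) <;>
    simp [mvyx, h1, h3, h5, h0, h6]
  field_simp
  ring

theorem good_flex (c : Fin 10 → ℝ) (h1 : c 1 = 0) (h5 : c 5 = 0) (h6 : c 6 ≠ 0)
    (hh : hc c 1 = 0) (hD : Dsc c ≠ 0) : Good c := by
  have h3 : c 3 = 0 := by
    simpa [hc, h1, h5, h6] using hh
  refine good_nine c h1 h3 h5 (fun h0 => hD ?_) h6
  simp only [Dsc, S16, T32, h0, h1, h3, h5]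
  ring

theorem good_tangent' (c : Fin 10 → ℝ) (h1 : c 1 = 0) (h6 : c 6 ≠ 0)
    (hh : hc c 1 = 0) (hD : Dsc c ≠ 0) : Good c := by
  refine Good.of_mvzx (-c 5 / c 6) (good_flex _ ?_ ?_ ?_ ?_ ?_)
  · simp [mvzx, h1]
  · simp [mvzx]
    field_simp
    ring
  · simp [mvzx, h6]
  · rw [← hh]
    simp only [hc, mvzx, Matrix.cons_val]
    ring
  · rwa [Dsc_mvzx]

theorem good_tangent (c : Fin 10 → ℝ) (h1 : c 1 = 0)
    (hh : hc c 1 = 0) (hD : Dsc c ≠ 0) : Good c := by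
  by_cases h6 : c 6 = 0
  · by_cases h5 : c 5 = 0
    · refine absurd ?_ hD
      simp only [Dsc, S16, T32, h1, h5, h6]
      ring
    · refine Good.of_mvxz 1 (good_tangent' _ ?_ ?_ ?_ ?_)
      · simp [mvxz, h1]
      · simp [mvxz, h6, h5]
      · rw [← hh]
        simp only [hc, mvxz, Matrix.cons_val]
        ring
      · rwa [Dsc_mvxz]
  · exact good_tangent' c h1 h6 hh hD

theorem good_point_one (c : Fin 10 → ℝ) (u v : ℝ) (h : ev c u 1 v = 0)
    (hh : ev (hc c) u 1 v = 0) (hD : Dsc c ≠ 0) : Good c := by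
  refine Good.of_mvxy u (Good.of_mvzy v (good_tangent _ ?_ ?_ ?_))
  · rw [← h]
    simp only [ev, mvxy, mvzy, Matrix.cons_val]
    ring
  · rw [← hh]
    simp only [ev, hc, mvxy, mvzy, Matrix.cons_val]
    ring
  · rwa [Dsc_mvzy, Dsc_mvxy]

theorem ev_scale (c : Fin 10 → ℝ) (x y z : ℝ) (hy : y ≠ 0) (h : ev c x y z = 0) :
    ev c (x / y) 1 (z / y) = 0 := by
  have : ev c (x / y) 1 (z / y) = ev c x y z / y ^ 3 := by
    simp only [ev]
    field_simp
  rw [this, h, zero_div]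

theorem good_point_y (c : Fin 10 → ℝ) (x y z : ℝ) (hy : y ≠ 0) (h : ev c x y z = 0)
    (hh : ev (hc c) x y z = 0) (hD : Dsc c ≠ 0) : Good c :=
  good_point_one c (x / y) (z / y) (ev_scale c x y z hy h) (ev_scale _ x y z hy hh) hD

theorem good_point (c : Fin 10 → ℝ) (x y z : ℝ) (hn : ¬(x = 0 ∧ y = 0 ∧ z = 0))
    (h : ev c x y z = 0) (hh : ev (hc c) x y z = 0) (hD : Dsc c ≠ 0) : Good c := by
  by_cases hy : y = 0
  · subst hy
    by_cases hx : x = 0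
    · subst hx
      have hz : z ≠ 0 := fun hz => hn ⟨rfl, rfl, hz⟩
      refine Good.of_mvyz (-1) (good_point_y _ 0 z z hz ?_ ?_ ?_)
      · refine Eq.trans ?_ h
        simp only [ev, mvyz, Matrix.cons_val]
        ring
      · refine Eq.trans ?_ hh
        simp only [ev, hc, mvyz, Matrix.cons_val]
        ring
      · rwa [Dsc_mvyz]
    · refine Good.of_mvyx (-1) (good_point_y _ x x z hx ?_ ?_ ?_)
      · refine Eq.trans ?_ h
        simp only [ev, mvyx, Matrix.cons_val]
        ring
      · refine Eq.trans ?_ hh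
        simp only [ev, hc, mvyx, Matrix.cons_val]
        ring
      · rwa [Dsc_mvyx]
  · exact good_point_y c x y z hy h hh hD

theorem good_of_Dsc (c : Fin 10 → ℝ) (hD : Dsc c ≠ 0) : Good c := by
  obtain ⟨v, hv, h1, h2⟩ := borsuk_ulam_two (fun v => ev c (v 0) (v 1) (v 2))
    (fun v => ev (hc c) (v 0) (v 1) (v 2)) (by unfold ev; fun_prop) (by unfold ev; fun_prop)
    (fun v => by simp only [ev, Pi.neg_apply]; ring)
    (fun v => by simp only [ev, Pi.neg_apply]; ring)
  refine good_point c _ _ _ (fun h => hv ?_) h1 h2 hD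
  ext i
  fin_cases i
  · exact h.1
  · exact h.2.1
  · exact h.2.2

theorem cubic_left {R : Type*} [CommRing R] (c : Fin 10 → R) :
    eval ![1, 0, 0] (cubic c) = c 0 ∧ eval ![0, 1, 0] (cubic c) = c 1 := by
  rw [cubic_eq]
  constructor <;> simp

/-- The minor showing that the generic form and its Hessian are independent. -/
theorem minor_ne : (X 0 * hc X 1 - X 1 * hc X 0 : MvPolynomial (Fin 10) ℚ) ≠ 0 := by
  intro h
  have := congrArg (eval (![1, 0, 0, 1, 0, 0, 1, 0, 0, 0] : Fin 10 → ℚ)) h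
  simp [hc] at this

theorem map_S16 {R S : Type*} [CommRing R] [CommRing S] (φ : R →+* S) (c : Fin 10 → R) :
    φ (S16 c) = S16 fun i => φ (c i) := by
  simp only [S16, map_add, map_sub, map_mul, map_pow, map_neg, map_ofNat]

theorem map_T32 {R S : Type*} [CommRing R] [CommRing S] (φ : R →+* S) (c : Fin 10 → R) :
    φ (T32 c) = T32 fun i => φ (c i) := by
  simp only [T32, map_add, map_sub, map_mul, map_pow, map_ofNat]

theorem pair_eq (P Q : MvPolynomial (Fin 10) ℚ) (hPQ : IsInvariantPair ℚ P Q) :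
    16 * P = S16 X ∧ 32 * Q = T32 X := by
  obtain ⟨-, -, h, hw⟩ := hPQ
  have hX : genCubic ℚ = cubic X := rfl
  rw [hX, hess_cubic, hess_cubic] at h
  have h0 := congrArg (eval ![1, 0, 0]) h
  have h1 := congrArg (eval ![0, 1, 0]) h
  simp only [map_add, map_mul, map_pow, map_ofNat, eval_C, (cubic_left _).1] at h0
  simp only [map_add, map_mul, map_pow, map_ofNat, eval_C, (cubic_left _).2] at h1
  rw [hess_hess_zero] at h0
  rw [hess_hess_one] at h1
  have hP : ((16 * P - S16 X) * (16 * P + S16 X)) * (48 * (X 0 * hc X 1 - X 1 * hc X 0)) = 0 := by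
    linear_combination hc X 0 * h1 - hc X 1 * h0
  have hQ : (32 * Q - T32 X) * (16 * (X 0 * hc X 1 - X 1 * hc X 0)) = 0 := by
    linear_combination X 1 * h0 - X 0 * h1
  have hQ' : 32 * Q = T32 X := by
    rcases mul_eq_zero.1 hQ with h | h
    · exact sub_eq_zero.1 h
    · exact absurd h (mul_ne_zero (by norm_num) minor_ne)
  refine ⟨?_, hQ'⟩
  rcases mul_eq_zero.1 hP with h | h
  · rcases mul_eq_zero.1 h with h | h
    · exact sub_eq_zero.1 h
    · exfalso
      have e := congrArg (aeval (wcoeffs (1 : ℚ) 0)) h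
      have e2 := map_S16 (aeval (wcoeffs (1 : ℚ) 0) : MvPolynomial (Fin 10) ℚ →ₐ[ℚ] ℚ).toRingHom X
      simp only [AlgHom.toRingHom_eq_coe, RingHom.coe_coe, aeval_X] at e2
      rw [map_add, map_mul, (hw 1 0).1, map_ofNat, e2, map_zero] at e
      simp [S16, wcoeffs] at e
      norm_num at e
  · exact absurd h (mul_ne_zero (by norm_num) minor_ne)

/-- Every ternary cubic form `f` over `ℝ` with `Δ(f) ≠ 0` is `SL₃(ℝ)`-equivalent to a
form in Weierstrass form: there exist `γ ∈ SL₃(ℝ)` and `A, B ∈ ℝ` with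
`γ·f = x³ + A·x·z² + B·z³ − y²·z`. -/
theorem stmt4 (P Q : MvPolynomial (Fin 10) ℚ) (hPQ : IsInvariantPair ℚ P Q)
    (c : Fin 10 → ℝ)
    (hΔ : (4 * (aeval c P : ℝ) ^ 3 - (aeval c Q : ℝ) ^ 2) / 27 ≠ 0) :
    ∃ (γ : Matrix.SpecialLinearGroup (Fin 3) ℝ) (A B : ℝ),
      actGL (γ : Matrix (Fin 3) (Fin 3) ℝ) (cubic c) = cubic (wcoeffs A B) := by
  refine good_of_Dsc c (fun hD => hΔ ?_)
  obtain ⟨hP, hQ⟩ := pair_eq P Q hPQ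
  have e1 := congrArg (aeval c) hP
  have e2 := congrArg (aeval c) hQ
  have m1 := map_S16 (aeval c : MvPolynomial (Fin 10) ℚ →ₐ[ℚ] ℝ).toRingHom X
  have m2 := map_T32 (aeval c : MvPolynomial (Fin 10) ℚ →ₐ[ℚ] ℝ).toRingHom X
  simp only [AlgHom.toRingHom_eq_coe, RingHom.coe_coe, aeval_X] at m1 m2
  rw [map_mul, map_ofNat, m1] at e1
  rw [map_mul, map_ofNat, m2] at e2
  rw [Dsc, ← e1, ← e2] at hD
  linear_combination hD / 27648
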